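/- Let C and D be monoidal categories and M a (C, D)-bimodule category with a distinguished object Dist, with colimit-preserving action functors act_C: C → M and act_D: D → M as above. Assume M is free of rank 1 over D, i.e. act_D: D → M, y ↦ Dist ⊗ y, is an equivalence of categories. Then the lax monoidal functor F = act_D^R ∘ act_C: C → D is strongly monoidal and preserves colimits. -/

import Mathlib

/-!
STATEMENT 7: Let `C` and `D` be monoidal categories and `M` a `(C, D)`-bimodule category with
a distinguished object `Dist`, with colimit-preserving action functors `act_C : C ⥤ M` and
`act_D : D ⥤ M` as in Statement 6.  Assume `M` is *free of rank 1* over `D`, i.e.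
`act_D : D ⥤ M`, `y ↦ Dist ⊗ y`, is an equivalence of categories.  Then the lax monoidal
functor `F = act_D^R ∘ act_C : C ⥤ D` (with the lax structure `(εF, μF)` of Statement 6) is
strongly monoidal and preserves colimits.
-/

open CategoryTheory Limits MonoidalCategory

universe v u

/-- The data of a `(C, D)`-bimodule category structure on a category `M`. -/
structure BimodCatData (C D M : Type u) [Category.{v} C] [Category.{v} D] [Category.{v} M]
    [MonoidalCategory C] [MonoidalCategory D] where
  /-- the left `C`-action, `(x, m) ↦ x ⊗ m` -/
  actL : C ⥤ M ⥤ M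
  /-- the right `D`-action, `(y, m) ↦ m ⊗ y` -/
  actR : D ⥤ M ⥤ M
  /-- left unitor `𝟙_C ⊗ m ≅ m` -/
  lunit : actL.obj (𝟙_ C) ≅ 𝟭 M
  /-- right unitor `m ⊗ 𝟙_D ≅ m` -/
  runit : actR.obj (𝟙_ D) ≅ 𝟭 M
  /-- left associator `x ⊗ (x' ⊗ m) ≅ (x ⊗ x') ⊗ m` -/
  lassoc : ∀ x x' : C, actL.obj x' ⋙ actL.obj x ≅ actL.obj (x ⊗ x')
  /-- right associator `(m ⊗ y) ⊗ y' ≅ m ⊗ (y ⊗ y')` -/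
  rassoc : ∀ y y' : D, actR.obj y ⋙ actR.obj y' ≅ actR.obj (y ⊗ y')
  /-- middle interchange `(x ⊗ m) ⊗ y ≅ x ⊗ (m ⊗ y)` -/
  middle : ∀ (x : C) (y : D), actL.obj x ⋙ actR.obj y ≅ actR.obj y ⋙ actL.obj x
  /-- naturality of the left associator in its first variable -/
  lassoc_nat₁ : ∀ {x₁ x₂ : C} (f : x₁ ⟶ x₂) (x' : C) (m : M),
    (actL.map f).app ((actL.obj x').obj m) ≫ (lassoc x₂ x').hom.app m
      = (lassoc x₁ x').hom.app m ≫ (actL.map (f ▷ x')).app m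
  /-- naturality of the left associator in its second variable -/
  lassoc_nat₂ : ∀ (x : C) {x'₁ x'₂ : C} (f : x'₁ ⟶ x'₂) (m : M),
    (actL.obj x).map ((actL.map f).app m) ≫ (lassoc x x'₂).hom.app m
      = (lassoc x x'₁).hom.app m ≫ (actL.map (x ◁ f)).app m
  /-- naturality of the right associator in its first variable -/
  rassoc_nat₁ : ∀ {y₁ y₂ : D} (f : y₁ ⟶ y₂) (y' : D) (m : M),
    (actR.obj y').map ((actR.map f).app m) ≫ (rassoc y₂ y').hom.app m
      = (rassoc y₁ y').hom.app m ≫ (actR.map (f ▷ y')).app m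
  /-- naturality of the right associator in its second variable -/
  rassoc_nat₂ : ∀ (y : D) {y'₁ y'₂ : D} (f : y'₁ ⟶ y'₂) (m : M),
    (actR.map f).app ((actR.obj y).obj m) ≫ (rassoc y y'₂).hom.app m
      = (rassoc y y'₁).hom.app m ≫ (actR.map (y ◁ f)).app m
  /-- naturality of the middle interchange in the `C`-variable -/
  middle_nat₁ : ∀ {x₁ x₂ : C} (f : x₁ ⟶ x₂) (y : D) (m : M),
    (actR.obj y).map ((actL.map f).app m) ≫ (middle x₂ y).hom.app m
      = (middle x₁ y).hom.app m ≫ (actL.map f).app ((actR.obj y).obj m)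
  /-- naturality of the middle interchange in the `D`-variable -/
  middle_nat₂ : ∀ (x : C) {y₁ y₂ : D} (f : y₁ ⟶ y₂) (m : M),
    (actR.map f).app ((actL.obj x).obj m) ≫ (middle x y₂).hom.app m
      = (middle x y₁).hom.app m ≫ (actL.obj x).map ((actR.map f).app m)
  /-- pentagon for the left action -/
  pentagon_l : ∀ (x₁ x₂ x₃ : C) (m : M),
    (actL.obj x₁).map ((lassoc x₂ x₃).hom.app m) ≫ (lassoc x₁ (x₂ ⊗ x₃)).hom.app m
      = (lassoc x₁ x₂).hom.app ((actL.obj x₃).obj m) ≫ (lassoc (x₁ ⊗ x₂) x₃).hom.app m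
          ≫ (actL.map (α_ x₁ x₂ x₃).hom).app m
  /-- triangle for the left action -/
  triangle_l : ∀ (x : C) (m : M),
    (actL.obj x).map (lunit.hom.app m)
      = (lassoc x (𝟙_ C)).hom.app m ≫ (actL.map (ρ_ x).hom).app m
  /-- pentagon for the right action -/
  pentagon_r : ∀ (y₁ y₂ y₃ : D) (m : M),
    (actR.obj y₃).map ((rassoc y₁ y₂).hom.app m) ≫ (rassoc (y₁ ⊗ y₂) y₃).hom.app m
        ≫ (actR.map (α_ y₁ y₂ y₃).hom).app m
      = (rassoc y₂ y₃).hom.app ((actR.obj y₁).obj m) ≫ (rassoc y₁ (y₂ ⊗ y₃)).hom.app m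
  /-- triangle for the right action -/
  triangle_r : ∀ (y : D) (m : M),
    (actR.obj y).map (runit.hom.app m)
      = (rassoc (𝟙_ D) y).hom.app m ≫ (actR.map (λ_ y).hom).app m

namespace BimodCatData

variable {C D M : Type u} [Category.{v} C] [Category.{v} D] [Category.{v} M]
  [MonoidalCategory C] [MonoidalCategory D]
  (B : BimodCatData C D M) (Dist : M)

/-- The functor `act_C : C ⥤ M`, `x ↦ x ⊗ Dist`. -/
def actC : C ⥤ M := B.actL.flip.obj Dist

/-- The functor `act_D : D ⥤ M`, `y ↦ Dist ⊗ y`. -/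
def actD : D ⥤ M := B.actR.flip.obj Dist

variable (aR : M ⥤ D) (adj : B.actD Dist ⊣ aR)

/-- The functor `F = act_D^R ∘ act_C : C ⥤ D`. -/
def F : C ⥤ D := B.actC Dist ⋙ aR

/-- The lax `D`-module structure `φ : act_D^R(m) ⊗ y ⟶ act_D^R(m ⊗ y)` on the right adjoint
`act_D^R` of `act_D`, obtained by adjunction from
`Dist ⊗ (act_D^R(m) ⊗ y) ≅ (Dist ⊗ act_D^R(m)) ⊗ y ⟶ m ⊗ y` (using the counit). -/
def φ (m : M) (y : D) : aR.obj m ⊗ y ⟶ aR.obj ((B.actR.obj y).obj m) :=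
  (adj.homEquiv (aR.obj m ⊗ y) ((B.actR.obj y).obj m))
    ((B.rassoc (aR.obj m) y).inv.app Dist ≫ (B.actR.obj y).map (adj.counit.app m))

/-- The unit morphism `1_D ⟶ F(1_C)`, i.e. the composite
`1_D → act_D^R(act_D(1_D)) ≅ act_D^R(act_C(1_C))` built from the unit of the adjunction. -/
def εF : 𝟙_ D ⟶ (B.F Dist aR).obj (𝟙_ C) :=
  adj.unit.app (𝟙_ D) ≫ aR.map (B.runit.hom.app Dist ≫ B.lunit.inv.app Dist)

/-- The multiplication `F(x) ⊗ F(y) ⟶ F(x ⊗ y)`: the composite of the lax module structure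
map `φ` with `act_D^R` applied to (the middle interchange,) `x` tensored with the counit of
the adjunction at `y ⊗ Dist`, and the left associator. -/
def μF (x y : C) :
    (B.F Dist aR).obj x ⊗ (B.F Dist aR).obj y ⟶ (B.F Dist aR).obj (x ⊗ y) :=
  B.φ Dist aR adj ((B.actC Dist).obj x) ((B.F Dist aR).obj y) ≫
    aR.map ((B.middle x ((B.F Dist aR).obj y)).hom.app Dist ≫
      (B.actL.obj x).map (adj.counit.app ((B.actC Dist).obj y)) ≫
      (B.lassoc x y).hom.app Dist)

end BimodCatData


/-- if `M` is free of rank 1 over `D` (i.e. `act_D` is an equivalence), then the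
lax monoidal functor `F = act_D^R ∘ act_C` is strongly monoidal (its unit and multiplication
maps are isomorphisms) and preserves colimits. -/
theorem actionAdjoint_monoidal_of_free_rank_one
    {C D M : Type u} [Category.{v} C] [Category.{v} D] [Category.{v} M]
    [MonoidalCategory C] [MonoidalCategory D]
    -- the categories are locally presentable; in particular cocomplete
    [HasColimits C] [HasColimits D] [HasColimits M]
    (B : BimodCatData C D M) (Dist : M)
    -- the action functors through the distinguished object preserve colimits
    (hC : Nonempty (PreservesColimits (B.actC Dist)))
    (hD : Nonempty (PreservesColimits (B.actD Dist)))
    -- the right adjoint of `act_D`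
    (aR : M ⥤ D) (adj : B.actD Dist ⊣ aR)
    -- `M` is free of rank 1 over `D`: the action functor `act_D` is an equivalence
    (hfree : (B.actD Dist).IsEquivalence) :
    IsIso (B.εF Dist aR adj) ∧
    (∀ x y : C, IsIso (B.μF Dist aR adj x y)) ∧
    Nonempty (PreservesColimits (B.F Dist aR)) := by
  have := hfree
  have hR : aR.IsEquivalence := adj.isEquivalence_right_of_isEquivalence_left
  obtain ⟨hC⟩ := hC
  have hu : ∀ y, IsIso (adj.unit.app y) := fun y => inferInstance
  have hc : ∀ m, IsIso (adj.counit.app m) := fun m => inferInstance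
  have hφ : ∀ m y, IsIso (B.φ Dist aR adj m y) := by
    intro m y
    unfold BimodCatData.φ
    rw [Adjunction.homEquiv_unit]
    have h1 : IsIso ((B.rassoc (aR.obj m) y).inv.app Dist) := inferInstance
    have h2 : IsIso ((B.actR.obj y).map (adj.counit.app m)) := inferInstance
    have h3 := @IsIso.comp_isIso _ _ _ _ _ _ _ h1 h2
    have h4 := @Functor.map_isIso _ _ _ _ _ _ aR _ h3
    exact @IsIso.comp_isIso _ _ _ _ _ _ _ (hu _) h4
  refine ⟨?_, ?_, ?_⟩
  · unfold BimodCatData.εF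
    have h3 : IsIso (B.runit.hom.app Dist ≫ B.lunit.inv.app Dist) := inferInstance
    have h4 := @Functor.map_isIso _ _ _ _ _ _ aR _ h3
    exact @IsIso.comp_isIso _ _ _ _ _ _ _ (hu _) h4
  · intro x y
    unfold BimodCatData.μF
    have h1 : IsIso ((B.middle x ((B.F Dist aR).obj y)).hom.app Dist) := inferInstance
    have h2 : IsIso ((B.actL.obj x).map (adj.counit.app ((B.actC Dist).obj y))) := inferInstance
    have h3 : IsIso ((B.lassoc x y).hom.app Dist) := inferInstance
    have h4 := @IsIso.comp_isIso _ _ _ _ _ _ _ h2 h3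
    have h5 := @IsIso.comp_isIso _ _ _ _ _ _ _ h1 h4
    have h6 := @Functor.map_isIso _ _ _ _ _ _ aR _ h5
    exact @IsIso.comp_isIso _ _ _ _ _ _ _ (hφ _ _) h6
  · unfold BimodCatData.F
    exact ⟨inferInstance⟩
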